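/- Let H be a Hilbert space and suppose tₑ → t weak-* in the trace-class operators N[H], and additionally that the trace norms converge: ‖tₑ‖_N → ‖t‖_N. Then tₑ → t strongly in trace norm. -/

import Mathlib

open Filter Topology
open scoped RealInnerProductSpace

noncomputable section

variable {H H₁ H₂ : Type*}

/-- Trace of an operator along a Hilbert basis. -/
def traceAlong [NormedAddCommGroup H] [InnerProductSpace ℝ H] {ι : Type*}
    (b : HilbertBasis ι ℝ H) (s : H →L[ℝ] H) : ℝ :=
  ∑' i, ⟪s (b i), b i⟫

/-- `t` is nuclear (trace-class) with nuclear (projective) norm at most `C`: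
it admits a representation `t = Σ xᵢ ⊗ yᵢ` with `Σ ‖xᵢ‖‖yᵢ‖ ≤ C`. -/
def IsNuclearWith [NormedAddCommGroup H₁] [InnerProductSpace ℝ H₁]
    [NormedAddCommGroup H₂] [InnerProductSpace ℝ H₂]
    (C : ℝ) (t : H₁ →L[ℝ] H₂) : Prop :=
  ∃ (x : ℕ → H₂) (y : ℕ → H₁),
    Summable (fun i => ‖x i‖ * ‖y i‖) ∧ (∑' i, ‖x i‖ * ‖y i‖) ≤ C ∧
      ∀ z : H₁, HasSum (fun i => ⟪y i, z⟫ • x i) (t z)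

/-- `t` is a nuclear (trace-class) operator. -/
def IsNuclear [NormedAddCommGroup H₁] [InnerProductSpace ℝ H₁]
    [NormedAddCommGroup H₂] [InnerProductSpace ℝ H₂] (t : H₁ →L[ℝ] H₂) : Prop :=
  ∃ C, IsNuclearWith C t

/-- The nuclear (trace/projective) norm of `t`. -/
def nuclearNorm [NormedAddCommGroup H₁] [InnerProductSpace ℝ H₁]
    [NormedAddCommGroup H₂] [InnerProductSpace ℝ H₂] (t : H₁ →L[ℝ] H₂) : ℝ :=
  sInf {C | IsNuclearWith C t}

/-- Weak-* convergence in `N[H] = K[H]*`: testing against every compact operator `q`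
via the trace pairing `(q,t) ↦ Tr(q t)`. -/
def WeakStarTendstoN [NormedAddCommGroup H] [InnerProductSpace ℝ H] {ι : Type*}
    (b : HilbertBasis ι ℝ H) (ts : ℕ → H →L[ℝ] H) (t : H →L[ℝ] H) : Prop :=
  ∀ q : H →L[ℝ] H, IsCompactOperator q →
    Tendsto (fun n => traceAlong b (q ∘L ts n)) atTop (𝓝 (traceAlong b (q ∘L t)))

end

section NuclearNorm

variable {E F : Type*} [NormedAddCommGroup E] [InnerProductSpace ℝ E]
  [NormedAddCommGroup F] [InnerProductSpace ℝ F]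

theorem IsNuclearWith.nonneg {C : ℝ} {s : E →L[ℝ] F} (h : IsNuclearWith C s) : 0 ≤ C := by
  obtain ⟨x, y, -, hC, -⟩ := h
  exact (tsum_nonneg fun i => by positivity).trans hC

theorem IsNuclearWith.nuclearNorm_le {C : ℝ} {s : E →L[ℝ] F} (h : IsNuclearWith C s) :
    nuclearNorm s ≤ C :=
  csInf_le ⟨0, fun _ hD => IsNuclearWith.nonneg hD⟩ h

theorem nuclearNorm_nonneg (s : E →L[ℝ] F) : 0 ≤ nuclearNorm s :=
  Real.sInf_nonneg fun _ hD => IsNuclearWith.nonneg hD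

theorem IsNuclear.exists_isNuclearWith_lt {s : E →L[ℝ] F} (h : IsNuclear s) {C : ℝ}
    (hC : nuclearNorm s < C) : ∃ D < C, IsNuclearWith D s := by
  obtain ⟨D, hD, hDC⟩ := exists_lt_of_csInf_lt h hC
  exact ⟨D, hDC, hD⟩

theorem IsNuclearWith.add {C D : ℝ} {s t : E →L[ℝ] F} (hs : IsNuclearWith C s)
    (ht : IsNuclearWith D t) : IsNuclearWith (C + D) (s + t) := by
  obtain ⟨x, y, hxy, hC, hsum⟩ := hs
  obtain ⟨u, v, huv, hD, hsum'⟩ := ht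
  let e := Equiv.natSumNatEquivNat.symm
  have key : HasSum (fun i => ‖Sum.elim x u (e i)‖ * ‖Sum.elim y v (e i)‖)
      ((∑' i, ‖x i‖ * ‖y i‖) + ∑' i, ‖u i‖ * ‖v i‖) :=
    (e.hasSum_iff (f := fun k => ‖Sum.elim x u k‖ * ‖Sum.elim y v k‖)).2
      (HasSum.sum hxy.hasSum huv.hasSum)
  refine ⟨fun i => Sum.elim x u (e i), fun i => Sum.elim y v (e i), key.summable, ?_, fun z => ?_⟩
  · rw [key.tsum_eq]
    exact add_le_add hC hD
  · exact (e.hasSum_iff (f := fun k => ⟪Sum.elim y v k, z⟫ • Sum.elim x u k)).2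
      (HasSum.sum (hsum z) (hsum' z))

theorem IsNuclear.add {s t : E →L[ℝ] F} (hs : IsNuclear s) (ht : IsNuclear t) :
    IsNuclear (s + t) := by
  obtain ⟨C, hC⟩ := hs
  obtain ⟨D, hD⟩ := ht
  exact ⟨C + D, hC.add hD⟩

theorem nuclearNorm_add_le {s t : E →L[ℝ] F} (hs : IsNuclear s) (ht : IsNuclear t) :
    nuclearNorm (s + t) ≤ nuclearNorm s + nuclearNorm t := by
  refine le_of_forall_pos_le_add fun ε hε => ?_
  obtain ⟨C, hC, hsC⟩ := hs.exists_isNuclearWith_lt (lt_add_of_pos_right _ (half_pos hε))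
  obtain ⟨D, hD, htD⟩ := ht.exists_isNuclearWith_lt (lt_add_of_pos_right _ (half_pos hε))
  linarith [(hsC.add htD).nuclearNorm_le]

theorem IsNuclearWith.neg {C : ℝ} {s : E →L[ℝ] F} (hs : IsNuclearWith C s) :
    IsNuclearWith C (-s) := by
  obtain ⟨x, y, hxy, hC, hsum⟩ := hs
  refine ⟨fun i => -x i, y, by simpa using hxy, by simpa using hC, fun z => ?_⟩
  simpa using (hsum z).neg

theorem IsNuclear.neg {s : E →L[ℝ] F} (hs : IsNuclear s) : IsNuclear (-s) := by
  obtain ⟨C, hC⟩ := hs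
  exact ⟨C, hC.neg⟩

theorem nuclearNorm_neg (s : E →L[ℝ] F) : nuclearNorm (-s) = nuclearNorm s := by
  have h : ∀ C, IsNuclearWith C (-s) ↔ IsNuclearWith C s :=
    fun C => ⟨fun h => by simpa using h.neg, IsNuclearWith.neg⟩
  simp only [nuclearNorm, h]

theorem IsNuclear.sub {s t : E →L[ℝ] F} (hs : IsNuclear s) (ht : IsNuclear t) :
    IsNuclear (s - t) := by
  rw [sub_eq_add_neg]
  exact hs.add ht.neg

theorem isNuclearWith_rankOne (x : F) (y : E) :
    IsNuclearWith (‖x‖ * ‖y‖) (InnerProductSpace.rankOne ℝ x y) := by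
  have key : HasSum (fun i : ℕ => ‖if i = 0 then x else 0‖ * ‖y‖) (‖x‖ * ‖y‖) := by
    convert hasSum_single (f := fun i : ℕ => ‖if i = 0 then x else 0‖ * ‖y‖) 0 (fun i hi => by simp [hi]) using 1
    simp
  refine ⟨fun i => if i = 0 then x else 0, fun _ => y, key.summable, key.tsum_eq.le, fun z => ?_⟩
  convert hasSum_single (f := fun i : ℕ => ⟪y, z⟫ • if i = 0 then x else 0) 0 (fun i hi => by simp [hi]) using 1
  simp

theorem isNuclearWith_zero : IsNuclearWith 0 (0 : E →L[ℝ] F) := by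
  simpa using isNuclearWith_rankOne (0 : F) (0 : E)

theorem IsNuclearWith.sum {α : Type*} (S : Finset α) {C : α → ℝ} {s : α → E →L[ℝ] F}
    (h : ∀ a ∈ S, IsNuclearWith (C a) (s a)) : IsNuclearWith (∑ a ∈ S, C a) (∑ a ∈ S, s a) := by
  classical
  induction S using Finset.induction_on with
  | empty => simpa using isNuclearWith_zero
  | insert a S ha ih =>
    rw [Finset.sum_insert ha, Finset.sum_insert ha]
    exact (h a (Finset.mem_insert_self a S)).add
      (ih fun b hb => h b (Finset.mem_insert_of_mem hb))

theorem HasSum.inner_smul_starProjection_conj {s : E →L[ℝ] F} {x : ℕ → F} {y : ℕ → E}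
    (h : ∀ z, HasSum (fun i => ⟪y i, z⟫ • x i) (s z))
    (K : Submodule ℝ E) [K.HasOrthogonalProjection] (A : F →L[ℝ] F) (z : E) :
    HasSum (fun i => ⟪K.starProjection (y i), z⟫ • A (x i)) ((A ∘L s ∘L K.starProjection) z) := by
  simpa [Submodule.inner_starProjection_left_eq_right] using (h (K.starProjection z)).mapL A

/-- The corner `P s P` of an operator, where `P` is the orthogonal projection onto `K`. -/
noncomputable def cornerCompression (K : Submodule ℝ E) [K.HasOrthogonalProjection] (s : E →L[ℝ] E) :
    E →L[ℝ] E :=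
  K.starProjection ∘L s ∘L K.starProjection

theorem cornerCompression_sub (K : Submodule ℝ E) [K.HasOrthogonalProjection]
    (s t : E →L[ℝ] E) :
    cornerCompression K (s - t) = cornerCompression K s - cornerCompression K t := by
  ext z
  simp [cornerCompression]

variable {s : E →L[ℝ] E} {x y : ℕ → E} (K : Submodule ℝ E) [K.HasOrthogonalProjection]

theorem norm_starProjection_mul_le (u v : E) :
    ‖K.starProjection u‖ * ‖K.starProjection v‖ ≤ ‖u‖ * ‖v‖ :=
  mul_le_mul (K.norm_starProjection_apply_le _) (K.norm_starProjection_apply_le _)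
    (norm_nonneg _) (norm_nonneg _)

theorem isNuclearWith_cornerCompression (hxy : Summable fun i => ‖x i‖ * ‖y i‖)
    (h : ∀ z, HasSum (fun i => ⟪y i, z⟫ • x i) (s z)) :
    IsNuclearWith (∑' i, ‖K.starProjection (x i)‖ * ‖K.starProjection (y i)‖)
      (cornerCompression K s) :=
  ⟨fun i => K.starProjection (x i), fun i => K.starProjection (y i),
    hxy.of_nonneg_of_le (fun _ => by positivity) fun _ => norm_starProjection_mul_le K _ _, le_rfl,
    HasSum.inner_smul_starProjection_conj h K _⟩

theorem IsNuclear.corner (h : IsNuclear s) : IsNuclear (cornerCompression K s) := by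
  obtain ⟨_, x, y, hxy, -, hs⟩ := h
  exact ⟨_, isNuclearWith_cornerCompression K hxy hs⟩

/-- The norm of `x ⊗ y - P x ⊗ P y` is bounded through the splitting
`x ⊗ Q y + Q x ⊗ P y`, where `Q = 1 - P`. -/
noncomputable def offCornerBound (u v : E) : ℝ :=
  ‖u‖ * ‖Kᗮ.starProjection v‖ + ‖Kᗮ.starProjection u‖ * ‖K.starProjection v‖

theorem offCornerBound_nonneg (u v : E) : 0 ≤ offCornerBound K u v := by
  unfold offCornerBound
  positivity

theorem offCornerBound_le (u v : E) : offCornerBound K u v ≤ 2 * (‖u‖ * ‖v‖) := by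
  have h₁ : ‖u‖ * ‖Kᗮ.starProjection v‖ ≤ ‖u‖ * ‖v‖ := by
    gcongr
    exact Kᗮ.norm_starProjection_apply_le v
  have h₂ : ‖Kᗮ.starProjection u‖ * ‖K.starProjection v‖ ≤ ‖u‖ * ‖v‖ := by
    gcongr
    · exact Kᗮ.norm_starProjection_apply_le u
    · exact K.norm_starProjection_apply_le v
  unfold offCornerBound
  linarith

theorem offCornerBound_sq_le (u v : E) :
    offCornerBound K u v ^ 2 ≤
      (‖u‖ * ‖v‖ - ‖K.starProjection u‖ * ‖K.starProjection v‖) * (4 * (‖u‖ * ‖v‖)) := by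
  have hu := Submodule.norm_sq_eq_add_norm_sq_starProjection u K
  have hv := Submodule.norm_sq_eq_add_norm_sq_starProjection v K
  set a := ‖u‖ * ‖Kᗮ.starProjection v‖
  set b := ‖Kᗮ.starProjection u‖ * ‖K.starProjection v‖
  set d := ‖u‖ * ‖v‖ with hd
  set c := ‖K.starProjection u‖ * ‖K.starProjection v‖ with hc
  have hcd : c ≤ d := norm_starProjection_mul_le K u v
  have hab : a ^ 2 + b ^ 2 = d ^ 2 - c ^ 2 := by
    simp only [a, b, hd, hc, mul_pow, hu, hv]
    ring
  have : (a + b) ^ 2 ≤ 2 * (d - c) * (d + c) := by nlinarith [sq_nonneg (a - b)]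
  unfold offCornerBound
  nlinarith [mul_nonneg (sub_nonneg.2 hcd) (sub_nonneg.2 hcd)]

theorem summable_offCornerBound (hxy : Summable fun i => ‖x i‖ * ‖y i‖) :
    Summable fun i => offCornerBound K (x i) (y i) :=
  (hxy.mul_left 2).of_nonneg_of_le (fun _ => offCornerBound_nonneg K _ _)
    fun _ => offCornerBound_le K _ _

theorem nuclearNorm_sub_cornerCompression_le_tsum (hxy : Summable fun i => ‖x i‖ * ‖y i‖)
    (h : ∀ z, HasSum (fun i => ⟪y i, z⟫ • x i) (s z)) :
    nuclearNorm (s - cornerCompression K s) ≤ ∑' i, offCornerBound K (x i) (y i) := by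
  have h₁ : Summable fun i => ‖x i‖ * ‖Kᗮ.starProjection (y i)‖ :=
    (summable_offCornerBound K hxy).of_nonneg_of_le (fun _ => by positivity)
      fun _ => le_add_of_nonneg_right (by positivity)
  have h₂ : Summable fun i => ‖Kᗮ.starProjection (x i)‖ * ‖K.starProjection (y i)‖ :=
    (summable_offCornerBound K hxy).of_nonneg_of_le (fun _ => by positivity)
      fun _ => le_add_of_nonneg_left (by positivity)
  have hsplit : s - cornerCompression K s =
      .id ℝ E ∘L s ∘L Kᗮ.starProjection + Kᗮ.starProjection ∘L s ∘L K.starProjection := by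
    ext z
    simp [cornerCompression, Submodule.starProjection_orthogonal]
  have := IsNuclearWith.add
    ⟨x, fun i => Kᗮ.starProjection (y i), h₁, le_rfl,
      HasSum.inner_smul_starProjection_conj h Kᗮ (.id ℝ E)⟩
    ⟨fun i => Kᗮ.starProjection (x i), fun i => K.starProjection (y i), h₂, le_rfl,
      HasSum.inner_smul_starProjection_conj h K Kᗮ.starProjection⟩
  rw [← hsplit, ← h₁.tsum_add h₂] at this
  exact this.nuclearNorm_le

theorem IsNuclear.nuclearNorm_sub_cornerCompression_sq_le (hs : IsNuclear s) :
    nuclearNorm (s - cornerCompression K s) ^ 2 ≤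
      (nuclearNorm s - nuclearNorm (cornerCompression K s)) * (4 * nuclearNorm s) := by
  have key : ∀ D, nuclearNorm s < D → nuclearNorm (s - cornerCompression K s) ^ 2 ≤
      (D - nuclearNorm (cornerCompression K s)) * (4 * D) := by
    intro D hD
    obtain ⟨C, hCD, x, y, hxy, hC, h⟩ := hs.exists_isNuclearWith_lt hD
    have hc : Summable fun i => ‖K.starProjection (x i)‖ * ‖K.starProjection (y i)‖ :=
      hxy.of_nonneg_of_le (fun _ => by positivity) fun _ => norm_starProjection_mul_le K _ _
    have hA := (isNuclearWith_cornerCompression K hxy h).nuclearNorm_le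
    have hlim := (summable_offCornerBound K hxy).hasSum.pow 2
    have hsq : (∑' i, offCornerBound K (x i) (y i)) ^ 2 ≤
        (∑' i, (‖x i‖ * ‖y i‖ - ‖K.starProjection (x i)‖ * ‖K.starProjection (y i)‖)) *
          ∑' i, 4 * (‖x i‖ * ‖y i‖) := by
      refine le_of_tendsto_of_tendsto' hlim
        (Tendsto.mul (hxy.sub hc).hasSum (hxy.mul_left 4).hasSum) fun S => ?_
      exact Finset.sum_sq_le_sum_mul_sum_of_sq_le_mul S
        (fun i _ => sub_nonneg.2 (norm_starProjection_mul_le K _ _))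
        (fun i _ => by positivity) fun i _ => offCornerBound_sq_le K _ _
    rw [hxy.tsum_sub hc, tsum_mul_left] at hsq
    have h0 : 0 ≤ ∑' i, ‖x i‖ * ‖y i‖ := tsum_nonneg fun _ => by positivity
    have hle := hc.tsum_le_tsum (fun i => norm_starProjection_mul_le K (x i) (y i)) hxy
    calc nuclearNorm (s - cornerCompression K s) ^ 2
        ≤ (∑' i, offCornerBound K (x i) (y i)) ^ 2 :=
          pow_le_pow_left₀ (nuclearNorm_nonneg _)
            (nuclearNorm_sub_cornerCompression_le_tsum K hxy h) 2
      _ ≤ _ := hsq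
      _ ≤ _ := by
          apply mul_le_mul <;> linarith
  refine ge_of_tendsto (x := 𝓝[>] nuclearNorm s) ?_ (eventually_mem_nhdsWithin.mono key)
  exact (Continuous.tendsto (f := fun D : ℝ =>
    (D - nuclearNorm (cornerCompression K s)) * (4 * D)) (by fun_prop) _).mono_left
      nhdsWithin_le_nhds


theorem IsNuclear.exists_finiteDimensional_nuclearNorm_sub_lt {s : E →L[ℝ] E} (hs : IsNuclear s)
    {δ : ℝ} (hδ : 0 < δ) :
    ∃ (K : Submodule ℝ E) (_ : FiniteDimensional ℝ K),
      nuclearNorm (s - cornerCompression K s) < δ := by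
  obtain ⟨_, x, y, hxy, -, h⟩ := hs
  obtain ⟨N, hN⟩ := ((tendsto_sum_nat_add fun i => ‖x i‖ * ‖y i‖).eventually_lt_const
    (half_pos hδ)).exists
  let K : Submodule ℝ E := Submodule.span ℝ (x '' Set.Iio N ∪ y '' Set.Iio N)
  have hK : FiniteDimensional ℝ K := FiniteDimensional.span_of_finite ℝ
    (((Set.finite_Iio N).image x).union ((Set.finite_Iio N).image y))
  refine ⟨K, hK, (nuclearNorm_sub_cornerCompression_le_tsum K hxy h).trans_lt ?_⟩
  have hoff := summable_offCornerBound K hxy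
  have hhead : ∀ i ∈ Finset.range N, offCornerBound K (x i) (y i) = 0 := by
    intro i hi
    have hi' : i ∈ Set.Iio N := Finset.mem_range.1 hi
    have hx : x i ∈ K := Submodule.subset_span (Or.inl ⟨i, hi', rfl⟩)
    have hy : y i ∈ K := Submodule.subset_span (Or.inr ⟨i, hi', rfl⟩)
    simp [offCornerBound, Submodule.starProjection_orthogonal,
      Submodule.starProjection_eq_self_iff.2 hx, Submodule.starProjection_eq_self_iff.2 hy]
  rw [← hoff.sum_add_tsum_nat_add N, Finset.sum_eq_zero hhead, zero_add]
  have htail := (summable_nat_add_iff N).2 hxy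
  calc ∑' i, offCornerBound K (x (i + N)) (y (i + N))
      ≤ ∑' i, 2 * (‖x (i + N)‖ * ‖y (i + N)‖) :=
        (summable_offCornerBound K htail).tsum_le_tsum (fun _ => offCornerBound_le K _ _)
          (htail.mul_left 2)
    _ < δ := by
        rw [tsum_mul_left]
        linarith

theorem cornerCompression_eq_sum_rankOne {α : Type*} [Fintype α] {K : Submodule ℝ E}
    [K.HasOrthogonalProjection] (e : OrthonormalBasis α ℝ K) (s : E →L[ℝ] E) :
    cornerCompression K s = ∑ p : α × α,
      InnerProductSpace.rankOne ℝ (⟪(e p.1 : E), s (e p.2)⟫ • (e p.1 : E)) (e p.2 : E) := by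
  ext z
  rw [Fintype.sum_prod_type_right]
  simp [cornerCompression, e.starProjection_eq_sum_rankOne, Finset.smul_sum, smul_smul, mul_comm]

theorem nuclearNorm_cornerCompression_le {α : Type*} [Fintype α] {K : Submodule ℝ E}
    [K.HasOrthogonalProjection] (e : OrthonormalBasis α ℝ K) (s : E →L[ℝ] E) :
    nuclearNorm (cornerCompression K s) ≤ ∑ p : α × α, |⟪(e p.1 : E), s (e p.2)⟫| := by
  have he : ∀ j, ‖(e j : E)‖ = 1 := fun j => e.norm_eq_one j
  rw [cornerCompression_eq_sum_rankOne e]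
  refine (IsNuclearWith.sum Finset.univ fun p _ => ?_).nuclearNorm_le
  simpa [norm_smul, he] using
    isNuclearWith_rankOne (⟪(e p.1 : E), s (e p.2)⟫ • (e p.1 : E)) (e p.2 : E)

theorem isCompactOperator_rankOne (u v : E) :
    IsCompactOperator (InnerProductSpace.rankOne ℝ u v) := by
  rw [InnerProductSpace.rankOne_def']
  exact (isCompactOperator_of_locallyCompactSpace_rng
    (ContinuousLinearMap.toSpanSingleton ℝ u)).comp_clm (innerSL ℝ v)

theorem traceAlong_rankOne_comp [CompleteSpace E] {ι : Type*} (b : HilbertBasis ι ℝ E)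
    (u v : E) (s : E →L[ℝ] E) :
    traceAlong b (InnerProductSpace.rankOne ℝ u v ∘L s) = ⟪v, s u⟫ := by
  rw [← ContinuousLinearMap.adjoint_inner_left, ← b.tsum_inner_mul_inner]
  refine tsum_congr fun i => ?_
  rw [ContinuousLinearMap.adjoint_inner_left]
  simp [real_inner_smul_left, real_inner_comm (b i) u]

theorem WeakStarTendstoN.tendsto_nuclearNorm_cornerCompression_sub [CompleteSpace E] {ι : Type*}
    {b : HilbertBasis ι ℝ E} {ts : ℕ → E →L[ℝ] E} {t : E →L[ℝ] E}
    (hw : WeakStarTendstoN b ts t) (K : Submodule ℝ E) [FiniteDimensional ℝ K] :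
    Tendsto (fun n => nuclearNorm (cornerCompression K (ts n - t))) atTop (𝓝 0) := by
  let e := stdOrthonormalBasis ℝ K
  refine squeeze_zero (fun _ => nuclearNorm_nonneg _)
    (fun n => nuclearNorm_cornerCompression_le e (ts n - t)) ?_
  rw [← Finset.sum_const_zero (ι := Fin (Module.finrank ℝ K) × Fin (Module.finrank ℝ K))
    (s := Finset.univ)]
  refine tendsto_finsetSum _ fun p _ => ?_
  have h := hw _ (isCompactOperator_rankOne (e p.2 : E) (e p.1 : E))
  simp only [traceAlong_rankOne_comp] at h
  simpa [inner_sub_right] using (h.sub_const ⟪(e p.1 : E), t (e p.2)⟫).abs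

theorem nuclearNorm_sub_le_of_cornerCompression {s t : E →L[ℝ] E} (hs : IsNuclear s)
    (ht : IsNuclear t) (K : Submodule ℝ E) [K.HasOrthogonalProjection] :
    nuclearNorm (s - t) ≤
      √((nuclearNorm s - nuclearNorm t + nuclearNorm (t - cornerCompression K t) +
          nuclearNorm (cornerCompression K (s - t))) * (4 * nuclearNorm s)) +
        nuclearNorm (cornerCompression K (s - t)) +
        nuclearNorm (t - cornerCompression K t) := by
  have hsK := hs.corner K
  have htK := ht.corner K
  have hstK := (hs.sub ht).corner K
  have hdecomp : s - t = (s - cornerCompression K s) + cornerCompression K (s - t) +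
      -(t - cornerCompression K t) := by
    rw [cornerCompression_sub]
    abel
  have htdecomp : t = (t - cornerCompression K t) + cornerCompression K s +
      -cornerCompression K (s - t) := by
    rw [cornerCompression_sub]
    abel
  have h₁ : nuclearNorm t ≤ nuclearNorm (t - cornerCompression K t) +
      nuclearNorm (cornerCompression K s) + nuclearNorm (cornerCompression K (s - t)) := by
    calc nuclearNorm t = _ := congrArg nuclearNorm htdecomp
      _ ≤ _ := nuclearNorm_add_le ((ht.sub htK).add hsK) hstK.neg
      _ ≤ _ := by
        rw [nuclearNorm_neg]
        gcongr
        exact nuclearNorm_add_le (ht.sub htK) hsK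
  have h₂ : nuclearNorm (s - cornerCompression K s) ≤
      √((nuclearNorm s - nuclearNorm t + nuclearNorm (t - cornerCompression K t) +
          nuclearNorm (cornerCompression K (s - t))) * (4 * nuclearNorm s)) := by
    refine Real.le_sqrt_of_sq_le ((hs.nuclearNorm_sub_cornerCompression_sq_le K).trans ?_)
    refine mul_le_mul_of_nonneg_right (by linarith) ?_
    linarith [nuclearNorm_nonneg s]
  calc nuclearNorm (s - t) = _ := congrArg nuclearNorm hdecomp
    _ ≤ _ := nuclearNorm_add_le ((hs.sub hsK).add hstK) (ht.sub htK).neg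
    _ ≤ _ := by
      rw [nuclearNorm_neg]
      gcongr
      exact (nuclearNorm_add_le (hs.sub hsK) hstK).trans (by gcongr)

end NuclearNorm


/- STATEMENT 6 (Radon–Riesz for trace-class): weak-* convergence together with
convergence of the trace norms implies convergence in trace norm. -/
theorem nuclear_weakStar_and_norm_implies_strong
    [NormedAddCommGroup H] [InnerProductSpace ℝ H] [CompleteSpace H]
    {ι : Type*} (b : HilbertBasis ι ℝ H)
    (ts : ℕ → H →L[ℝ] H) (t : H →L[ℝ] H)
    (hts : ∀ n, IsNuclear (ts n)) (ht : IsNuclear t)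
    (hw : WeakStarTendstoN b ts t)
    (hnorm : Filter.Tendsto (fun n => nuclearNorm (ts n)) Filter.atTop
      (nhds (nuclearNorm t))) :
    Filter.Tendsto (fun n => nuclearNorm (ts n - t)) Filter.atTop (nhds 0) := by
  refine tendsto_order.2 ⟨fun a ha => Eventually.of_forall fun n =>
    ha.trans_le (nuclearNorm_nonneg _), fun ε hε => ?_⟩
  obtain ⟨δ, hδε, hδ⟩ : ∃ δ : ℝ, √(δ * (4 * nuclearNorm t)) + δ < ε ∧ 0 < δ := by
    have hlim : Tendsto (fun δ : ℝ => √(δ * (4 * nuclearNorm t)) + δ) (𝓝[>] 0) (𝓝 0) := by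
      have hcont : Continuous fun δ : ℝ => √(δ * (4 * nuclearNorm t)) + δ := by fun_prop
      simpa using (hcont.tendsto 0).mono_left nhdsWithin_le_nhds
    exact ((hlim.eventually_lt_const hε).and eventually_mem_nhdsWithin).exists
  obtain ⟨K, _, hK⟩ := ht.exists_finiteDimensional_nuclearNorm_sub_lt hδ
  have hη := hw.tendsto_nuclearNorm_cornerCompression_sub K
  have hbound : √(nuclearNorm (t - cornerCompression K t) * (4 * nuclearNorm t)) +
      nuclearNorm (t - cornerCompression K t) < ε := by
    refine lt_of_le_of_lt ?_ hδε
    have := nuclearNorm_nonneg t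
    gcongr
  have hlim := (((((hnorm.sub_const (nuclearNorm t)).add_const
    (nuclearNorm (t - cornerCompression K t))).add hη).mul (hnorm.const_mul 4)).sqrt.add
      hη).add_const (nuclearNorm (t - cornerCompression K t))
  simp only [sub_self, zero_add, add_zero] at hlim
  exact (hlim.eventually_lt_const hbound).mono fun n hn =>
    (nuclearNorm_sub_le_of_cornerCompression (hts n) ht K).trans_lt hn
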